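/- Let n ≥ 18 be odd and let F be an intersecting butterfly-free family of subsets of [n] with |F| = Σ_I(n,2). Then F is exactly the union of the two levels of sizes ⌊n/2⌋+1 and ⌊n/2⌋+2, i.e., F = {S ⊆ [n] : |S| = ⌊n/2⌋+1 or |S| = ⌊n/2⌋+2}. -/

import Mathlib

/-- `Σ_I(n,k)` from the paper. -/
def SigmaI (n k : ℕ) : ℕ :=
  if n % 2 = 1 then
    ∑ i ∈ Finset.Icc ((n + 1) / 2) ((n + 1) / 2 + k - 1), Nat.choose n i
  else
    Nat.choose (n - 1) (n / 2 - 1) +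
      ∑ i ∈ Finset.Icc (n / 2 + 1) (n / 2 + k - 1), Nat.choose n i +
      Nat.choose (n - 1) (n / 2 + k)

/-- A family of finite sets is intersecting if any two members meet. -/
def Intersecting {α : Type*} [DecidableEq α] (F : Finset (Finset α)) : Prop :=
  ∀ A ∈ F, ∀ B ∈ F, (A ∩ B).Nonempty

/-- A family is butterfly-free if there are no four distinct members
`A,B,C,D` with `A ⊆ C`, `A ⊆ D`, `B ⊆ C`, `B ⊆ D`. -/
def ButterflyFree {α : Type*} (F : Finset (Finset α)) : Prop :=
  ¬ ∃ A B C D : Finset α, A ∈ F ∧ B ∈ F ∧ C ∈ F ∧ D ∈ F ∧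
    A ≠ B ∧ A ≠ C ∧ A ≠ D ∧ B ≠ C ∧ B ≠ D ∧ C ≠ D ∧
    A ⊆ C ∧ A ⊆ D ∧ B ⊆ C ∧ B ⊆ D

/-- A family is `k`-Sperner if it contains no chain of `k+1` distinct sets. -/
def KSperner {α : Type*} (k : ℕ) (F : Finset (Finset α)) : Prop :=
  ¬ ∃ c : Fin (k + 1) → Finset α, (∀ i, c i ∈ F) ∧ StrictMono c

open Finset Numbering in
/-- Swapping two elements shows that at most half of the numberings having `A` as a prefix
also have `X` as a prefix. -/
theorem two_mul_card_prefixed_inter_le {α : Type*} [Fintype α] [DecidableEq α]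
    {A X : Finset α} {u v : α} (hu : u ∈ X) (hv : v ∉ X) (huv : u ∈ A ↔ v ∈ A) :
    2 * #(prefixed A ∩ prefixed X) ≤ #(prefixed A) := by
  have key : #(prefixed A ∩ prefixed X) ≤ #(prefixed A \ prefixed X) := by
    refine card_le_card_of_injOn (fun f => (Equiv.swap u v).trans f) ?_ ?_
    · intro f hf
      simp only [coe_inter, Set.mem_inter_iff, mem_coe, mem_prefixed, coe_sdiff,
        Set.mem_sdiff] at hf ⊢
      obtain ⟨hA, hX⟩ := hf
      refine ⟨fun x => ?_, fun h => hv ?_⟩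
      · rw [Equiv.trans_apply, ← hA]
        rcases eq_or_ne x u with rfl | hxu
        · simpa using huv
        rcases eq_or_ne x v with rfl | hxv
        · simpa using huv.symm
        · rw [Equiv.swap_apply_of_ne_of_ne hxu hxv]
      · have := (h u).1 hu
        rw [Equiv.trans_apply, Equiv.swap_apply_left] at this
        exact (hX v).2 this
    · intro f _ g _ h
      ext x
      have := congrArg (fun e => e (Equiv.swap u v x)) h
      simpa using congrArg Fin.val this
  have := card_inter_add_card_sdiff (prefixed A) (prefixed X)
  omega

/-- The Lubell weight of a set: the proportion of maximal chains passing through it. -/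
def lubellWeight {α : Type*} [Fintype α] (A : Finset α) : ℚ :=
  ((Fintype.card α).choose A.card : ℚ)⁻¹

open Finset Numbering Nat in
theorem card_prefixed_eq_factorial_mul {α : Type*} [Fintype α] [DecidableEq α] (A : Finset α) :
    (#(prefixed A) : ℚ) = (Fintype.card α)! * lubellWeight A := by
  rw [card_prefixed, lubellWeight, Nat.cast_choose ℚ A.card_le_univ]
  have := Nat.factorial_ne_zero (Fintype.card α)
  push_cast
  field_simp

open Finset Numbering Nat in
/-- A Lubell inequality for families in which each member of `N` is comparable to one
designated further member, provided at most half of the chains through a member of `N` contain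
the designated one. -/
theorem sum_lubellWeight_add_sum_sdiff_le_two {α : Type*} [Fintype α] [DecidableEq α]
    {H N : Finset (Finset α)} (hN : N ⊆ H) (g : Finset α → Finset α)
    (hg : ∀ A ∈ N, 2 * #(prefixed A ∩ prefixed (g A)) ≤ #(prefixed A))
    (hH : ∀ A ∈ H, ∀ B ∈ H, A ⊂ B → (A ∈ N ∧ g A = B) ∨ (B ∈ N ∧ g B = A)) :
    ∑ A ∈ H, lubellWeight A + ∑ A ∈ H \ N, lubellWeight A ≤ 2 := by
  set R : Finset α → Finset (Numbering α) := fun A =>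
    if A ∈ N then prefixed A \ prefixed (g A) else prefixed A with hR
  have hdisj : (H : Set (Finset α)).PairwiseDisjoint R := by
    intro A hA B hB hAB
    refine Finset.disjoint_left.2 fun f hfA hfB => ?_
    have sub : ∀ C, f ∈ R C → f ∈ prefixed C ∧ (C ∈ N → f ∉ prefixed (g C)) := by
      intro C hC
      simp only [hR] at hC
      split_ifs at hC with h
      · exact ⟨(mem_sdiff.1 hC).1, fun _ => (mem_sdiff.1 hC).2⟩
      · exact ⟨hC, fun h' => absurd h' h⟩
    obtain ⟨hA1, hA2⟩ := sub A hfA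
    obtain ⟨hB1, hB2⟩ := sub B hfB
    have hcomp : A ⊂ B ∨ B ⊂ A := by
      rcases Nat.le_total #A #B with h | h
      · exact Or.inl (LE.le.ssubset_of_ne
          ((mem_prefixed.1 hA1).subset_of_card_le_card (mem_prefixed.1 hB1) h) hAB)
      · exact Or.inr (LE.le.ssubset_of_ne
          ((mem_prefixed.1 hB1).subset_of_card_le_card (mem_prefixed.1 hA1) h) hAB.symm)
    rcases hcomp with h | h
    · rcases hH A hA B hB h with ⟨h1, h2⟩ | ⟨h1, h2⟩
      · exact hA2 h1 (h2 ▸ hB1)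
      · exact hB2 h1 (h2 ▸ hA1)
    · rcases hH B hB A hA h with ⟨h1, h2⟩ | ⟨h1, h2⟩
      · exact hB2 h1 (h2 ▸ hA1)
      · exact hA2 h1 (h2 ▸ hB1)
  have htot : ∑ A ∈ H, #(R A) ≤ (Fintype.card α)! := by
    rw [← card_biUnion hdisj, ← Fintype.card_numbering (X := α)]
    exact card_le_univ _
  have hhalf : ∀ A ∈ N, #(prefixed A) ≤ 2 * #(R A) := by
    intro A hA
    have h1 := hg A hA
    have h2 := card_inter_add_card_sdiff (prefixed A) (prefixed (g A))
    simp only [hR, if_pos hA]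
    omega
  have hfull : ∀ A ∈ H \ N, #(R A) = #(prefixed A) := by
    intro A hA
    simp only [hR, if_neg (mem_sdiff.1 hA).2]
  have hnat : ∑ A ∈ H, #(prefixed A) + ∑ A ∈ H \ N, #(prefixed A) ≤ 2 * (Fintype.card α)! := by
    have h1 := sum_sdiff hN (f := fun A => #(prefixed A))
    have h2 := sum_sdiff hN (f := fun A => #(R A))
    have h3 := sum_le_sum hhalf
    rw [← mul_sum] at h3
    have h4 := sum_congr rfl hfull
    omega
  have hq : ((∑ A ∈ H, #(prefixed A) + ∑ A ∈ H \ N, #(prefixed A) : ℕ) : ℚ)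
      ≤ (2 * (Fintype.card α)! : ℕ) := by exact_mod_cast hnat
  push_cast [card_prefixed_eq_factorial_mul] at hq
  rw [← mul_sum, ← mul_sum, ← mul_add, mul_comm (2 : ℚ)] at hq
  exact le_of_mul_le_mul_left hq (by exact_mod_cast Nat.factorial_pos _)

open Finset in
theorem sum_lubellWeight_add_sum_minimal_le_two {α : Type*} [Fintype α] [DecidableEq α]
    {H : Finset (Finset α)} (h0 : ∅ ∉ H)
    (hH : ∀ A ∈ H, ∀ B ∈ H, ∀ C ∈ H, B ⊂ A → C ⊂ A → B = C) :
    ∑ A ∈ H, lubellWeight A + ∑ A ∈ H with (∀ B ∈ H, ¬ B ⊂ A), lubellWeight A ≤ 2 := by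
  have hex : ∀ A : Finset α, ∃ X, A ∈ H → (∃ B ∈ H, B ⊂ A) → X ∈ H ∧ X ⊂ A := by
    intro A
    by_cases h : ∃ B ∈ H, B ⊂ A
    · exact ⟨h.choose, fun _ _ => h.choose_spec⟩
    · exact ⟨∅, fun _ h' => absurd h' h⟩
  choose g hg using hex
  have key := sum_lubellWeight_add_sum_sdiff_le_two (H := H)
    (N := {A ∈ H | ∃ B ∈ H, B ⊂ A}) (filter_subset _ _) g ?_ ?_
  · convert key using 3
    ext A
    simp only [mem_filter, mem_sdiff]
    grind
  · intro A hA
    obtain ⟨hA, hB⟩ := mem_filter.1 hA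
    obtain ⟨hX, hXA⟩ := hg A hA hB
    obtain ⟨v, hvA, hvX⟩ := exists_of_ssubset hXA
    obtain ⟨u, hu⟩ : (g A).Nonempty := by
      rw [nonempty_iff_ne_empty]
      rintro h
      exact h0 (h ▸ hX)
    exact two_mul_card_prefixed_inter_le hu hvX (by simp [hvA, hXA.1 hu])
  · intro A hA B hB hAB
    obtain ⟨hX, hXB⟩ := hg B hB ⟨A, hA, hAB⟩
    exact Or.inr ⟨mem_filter.2 ⟨hB, A, hA, hAB⟩, hH B hB _ hX A hA hXB hAB⟩

open Finset in
theorem sum_lubellWeight_add_sum_maximal_le_two {α : Type*} [Fintype α] [DecidableEq α]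
    {H : Finset (Finset α)} (h1 : univ ∉ H)
    (hH : ∀ A ∈ H, ∀ B ∈ H, ∀ C ∈ H, A ⊂ B → A ⊂ C → B = C) :
    ∑ A ∈ H, lubellWeight A + ∑ A ∈ H with (∀ B ∈ H, ¬ A ⊂ B), lubellWeight A ≤ 2 := by
  have hex : ∀ A : Finset α, ∃ X, A ∈ H → (∃ B ∈ H, A ⊂ B) → X ∈ H ∧ A ⊂ X := by
    intro A
    by_cases h : ∃ B ∈ H, A ⊂ B
    · exact ⟨h.choose, fun _ _ => h.choose_spec⟩
    · exact ⟨∅, fun _ h' => absurd h' h⟩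
  choose g hg using hex
  have key := sum_lubellWeight_add_sum_sdiff_le_two (H := H)
    (N := {A ∈ H | ∃ B ∈ H, A ⊂ B}) (filter_subset _ _) g ?_ ?_
  · convert key using 3
    ext A
    simp only [mem_filter, mem_sdiff]
    grind
  · intro A hA
    obtain ⟨hA, hB⟩ := mem_filter.1 hA
    obtain ⟨hX, hAX⟩ := hg A hA hB
    obtain ⟨u, hu, huA⟩ := exists_of_ssubset hAX
    obtain ⟨v, hv⟩ : ∃ v, v ∉ g A := by
      by_contra! h
      exact h1 (eq_univ_iff_forall.2 h ▸ hX)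
    exact two_mul_card_prefixed_inter_le hu hv
      (by simpa [huA] using fun h => hv (hAX.1 h))
  · intro A hA B hB hAB
    obtain ⟨hX, hAX⟩ := hg A hA ⟨B, hB, hAB⟩
    exact Or.inl ⟨mem_filter.2 ⟨hA, B, hB, hAB⟩, hH A hA _ hX B hB hAX hAB⟩


theorem ButterflyFree.false_of_ssubset {α : Type*} {F : Finset (Finset α)} (hF : ButterflyFree F)
    {A B C D : Finset α} (hA : A ∈ F) (hB : B ∈ F) (hC : C ∈ F) (hD : D ∈ F)
    (hAB : A ≠ B) (hCD : C ≠ D) (hAC : A ⊂ C) (hAD : A ⊂ D) (hBC : B ⊂ C) (hBD : B ⊂ D) :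
    False :=
  hF ⟨A, B, C, D, hA, hB, hC, hD, hAB, hAC.ne, hAD.ne, hBC.ne, hBD.ne, hCD,
    hAC.1, hAD.1, hBC.1, hBD.1⟩

theorem lubellWeight_pos {α : Type*} [Fintype α] (A : Finset α) : 0 < lubellWeight A := by
  have := Nat.choose_pos A.card_le_univ
  rw [lubellWeight]
  positivity

open Finset in
theorem ButterflyFree.sum_lubellWeight_le_two {α : Type*} [Fintype α] [DecidableEq α]
    {F : Finset (Finset α)} (hF : ButterflyFree F) (h0 : ∅ ∉ F) (h1 : univ ∉ F) :
    ∑ A ∈ F, lubellWeight A ≤ 2 := by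
  set Mi : Finset (Finset α) := {A ∈ F | ¬ ∃ B ∈ F, B ⊂ A} with hMi
  set H₂ : Finset (Finset α) := {A ∈ F | ∃ B ∈ F, B ⊂ A} with hH₂
  set Ma : Finset (Finset α) := {A ∈ H₂ | ∀ B ∈ F, ¬ A ⊂ B} with hMa
  have hMaF : Ma ⊆ F := (filter_subset _ _).trans (filter_subset _ _)
  have low := sum_lubellWeight_add_sum_minimal_le_two (H := F \ Ma)
    (fun h => h0 (mem_sdiff.1 h).1) (by
      intro A hA B hB C hC hBA hCA
      by_contra hBC
      rw [mem_sdiff] at hA hB hC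
      obtain ⟨Y, hY, hAY⟩ : ∃ Y ∈ F, A ⊂ Y := by
        by_contra! h
        exact hA.2 (mem_filter.2 ⟨mem_filter.2 ⟨hA.1, B, hB.1, hBA⟩, h⟩)
      exact hF.false_of_ssubset hB.1 hC.1 hA.1 hY hBC hAY.ne hBA (hBA.trans hAY) hCA
        (hCA.trans hAY))
  have high := sum_lubellWeight_add_sum_maximal_le_two (H := H₂)
    (fun h => h1 (mem_filter.1 h).1) (by
      intro A hA B hB C hC hAB hAC
      by_contra hBC
      obtain ⟨hA, X, hX, hXA⟩ := mem_filter.1 hA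
      exact hF.false_of_ssubset hX hA (mem_filter.1 hB).1 (mem_filter.1 hC).1 hXA.ne hBC
        (hXA.trans hAB) (hXA.trans hAC) hAB hAC)
  have low' : ∑ A ∈ Mi, lubellWeight A
      ≤ ∑ A ∈ F \ Ma with (∀ B ∈ F \ Ma, ¬ B ⊂ A), lubellWeight A := by
    refine sum_le_sum_of_subset_of_nonneg ?_ fun A _ _ => (lubellWeight_pos A).le
    intro A hA
    obtain ⟨hA, h⟩ := mem_filter.1 hA
    refine mem_filter.2 ⟨mem_sdiff.2 ⟨hA, fun h' => ?_⟩, fun B hB hBA => ?_⟩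
    · exact h (mem_filter.1 (mem_filter.1 h').1).2
    · exact h ⟨B, (mem_sdiff.1 hB).1, hBA⟩
  have high' : ∑ A ∈ Ma, lubellWeight A
      ≤ ∑ A ∈ H₂ with (∀ B ∈ H₂, ¬ A ⊂ B), lubellWeight A := by
    refine sum_le_sum_of_subset_of_nonneg ?_ fun A _ _ => (lubellWeight_pos A).le
    intro A hA
    obtain ⟨hA, h⟩ := mem_filter.1 hA
    exact mem_filter.2 ⟨hA, fun B hB => h B (mem_filter.1 hB).1⟩
  have e1 := sum_sdiff hMaF (f := lubellWeight)
  have e2 := sum_filter_add_sum_filter_not F (fun A => ∃ B ∈ F, B ⊂ A) lubellWeight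
  rw [← hH₂, ← hMi] at e2
  linarith

theorem Nat.choose_lt_choose_of_half_lt {n k l : ℕ} (hk : n ≤ 2 * k) (hkn : k ≤ n)
    (hkl : k < l) : n.choose l < n.choose k := by
  induction l, hkl using Nat.le_induction with
  | base =>
    have h := Nat.choose_succ_right_eq n k
    have hpos := Nat.choose_pos hkn
    have : n.choose k * (n - k) < n.choose k * (k + 1) :=
      Nat.mul_lt_mul_of_pos_left (by omega) hpos
    exact lt_of_mul_lt_mul_right (h ▸ this) (Nat.zero_le (k + 1))
  | succ l hl ih =>
    refine lt_of_le_of_lt ?_ ih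
    have h := Nat.choose_succ_right_eq n l
    have : n.choose l * (n - l) ≤ n.choose l * (l + 1) := Nat.mul_le_mul_left _ (by omega)
    exact le_of_mul_le_mul_right (h ▸ this) (Nat.succ_pos l)

/-- All levels other than the four middle ones are smaller than the level `m + 2`. -/
theorem choose_lt_choose_add_two {m a : ℕ} (ha : a ≤ 2 * m + 1) (h : a + 1 < m ∨ m + 2 < a) :
    (2 * m + 1).choose a < (2 * m + 1).choose (m + 2) := by
  rcases h with h | h
  · rw [← Nat.choose_symm ha]
    exact Nat.choose_lt_choose_of_half_lt (by omega) (by omega) (by omega)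
  · exact Nat.choose_lt_choose_of_half_lt (by omega) (by omega) (by omega)

theorem choose_eq_choose_add_two {m a : ℕ} (h : a + 1 = m ∨ a = m + 2) :
    (2 * m + 1).choose a = (2 * m + 1).choose (m + 2) := by
  rcases h with h | rfl
  · rw [← Nat.choose_symm (by omega)]
    congr 1
    omega
  · rfl

theorem choose_eq_choose_middle {m a : ℕ} (h : a = m ∨ a = m + 1) :
    (2 * m + 1).choose a = (2 * m + 1).choose m := by
  rcases h with rfl | rfl
  · rfl
  · exact Nat.choose_symm_half m

section Complements

open Finset

variable {α : Type*} [Fintype α] [DecidableEq α] {F : Finset (Finset α)} {k l : ℕ}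

theorem Intersecting.compl_notMem (hF : Intersecting F) {A B : Finset α} (hA : A ∈ F)
    (hAB : A ⊆ B) : Bᶜ ∉ F := by
  intro hB
  obtain ⟨x, hx⟩ := hF A hA _ hB
  simp only [mem_inter, mem_compl] at hx
  exact hx.2 (hAB hx.1)

/-- Replacing the `k`-sets of an intersecting family by their complements embeds
its two levels `k` and `l = n - k` into the level `l`. -/
theorem Intersecting.exists_image_card_eq (hF : Intersecting F) (hkl : k + l = Fintype.card α) :
    ∃ G ⊆ powersetCard l (univ : Finset α), #G = #{A ∈ F | #A = k ∨ #A = l} ∧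
      ∀ B ∈ G, B ∈ F ∨ Bᶜ ∈ F := by
  refine ⟨image (fun A => if #A = k then Aᶜ else A) {A ∈ F | #A = k ∨ #A = l}, ?_, ?_, ?_⟩
  · intro B hB
    obtain ⟨A, hA, rfl⟩ := mem_image.1 hB
    obtain ⟨-, hA⟩ := mem_filter.1 hA
    rw [mem_powersetCard_univ]
    split_ifs with h
    · rw [card_compl]
      omega
    · exact hA.resolve_left h
  · refine card_image_of_injOn fun A hA B hB h => ?_
    obtain ⟨hA, -⟩ := mem_filter.1 hA
    obtain ⟨hB, -⟩ := mem_filter.1 hB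
    split_ifs at h with h1 h2 h2
    · exact compl_injective h
    · exact absurd (h ▸ hB) (hF.compl_notMem hA Subset.rfl)
    · exact absurd (h ▸ hA) (hF.compl_notMem hB Subset.rfl)
    · exact h
  · intro B hB
    obtain ⟨A, hA, rfl⟩ := mem_image.1 hB
    obtain ⟨hA, -⟩ := mem_filter.1 hA
    split_ifs with h
    · exact Or.inr (by rwa [compl_compl])
    · exact Or.inl hA

theorem Intersecting.card_two_levels_le (hF : Intersecting F) (hkl : k + l = Fintype.card α) :
    #{A ∈ F | #A = k ∨ #A = l} ≤ (Fintype.card α).choose l := by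
  obtain ⟨G, hG, hcard, -⟩ := hF.exists_image_card_eq hkl
  rw [← hcard, ← card_univ, ← card_powersetCard]
  exact card_le_card hG

theorem Intersecting.mem_or_compl_mem (hF : Intersecting F) (hkl : k + l = Fintype.card α)
    (hcard : (Fintype.card α).choose l ≤ #{A ∈ F | #A = k ∨ #A = l})
    {B : Finset α} (hB : #B = k ∨ #B = l) : B ∈ F ∨ Bᶜ ∈ F := by
  obtain ⟨G, hG, hGcard, hmem⟩ := hF.exists_image_card_eq hkl
  have hGeq : G = powersetCard l univ :=
    eq_of_subset_of_card_le hG (by rwa [hGcard, card_powersetCard, card_univ])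
  rcases hB with hB | hB
  · have := hmem Bᶜ (by
      rw [hGeq, mem_powersetCard_univ, card_compl]
      omega)
    rw [compl_compl] at this
    exact this.symm
  · exact hmem B (by rw [hGeq, mem_powersetCard_univ, hB])

end Complements

section OddGroundSet

open Finset

variable {m : ℕ} {F : Finset (Finset (Fin (2 * m + 1)))}

theorem card_eq_of_lubellWeight (F : Finset (Finset (Fin (2 * m + 1)))) :
    (#F : ℚ) = (2 * m + 1).choose m
      + (2 * m + 1).choose (m + 2) * (∑ A ∈ F, lubellWeight A - 1)
      - ((2 * m + 1).choose m - (2 * m + 1).choose (m + 2))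
        * (1 - #{A ∈ F | #A = m ∨ #A = m + 1} / (2 * m + 1).choose m)
      - ∑ A ∈ F with ¬ (#A = m ∨ #A = m + 1),
          ((2 * m + 1).choose (m + 2) * lubellWeight A - 1) := by
  have hP : ((2 * m + 1).choose m : ℚ) ≠ 0 := by
    exact_mod_cast (Nat.choose_pos (by omega)).ne'
  have h1 := sum_filter_add_sum_filter_not F (fun A => #A = m ∨ #A = m + 1) lubellWeight
  have h2 : ∑ A ∈ F with (#A = m ∨ #A = m + 1), lubellWeight A
      = #{A ∈ F | #A = m ∨ #A = m + 1} / (2 * m + 1).choose m := by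
    rw [div_eq_mul_inv, ← nsmul_eq_mul, ← sum_const]
    refine sum_congr rfl fun A hA => ?_
    rw [lubellWeight, Fintype.card_fin, choose_eq_choose_middle (mem_filter.1 hA).2]
  have h3 : (#{A ∈ F | #A = m ∨ #A = m + 1} : ℚ) + #{A ∈ F | ¬ (#A = m ∨ #A = m + 1)} = #F := by
    exact_mod_cast card_filter_add_card_filter_not (s := F) _
  rw [sum_sub_distrib, ← mul_sum, sum_const, nsmul_eq_mul, mul_one, ← h1, ← h3, h2]
  field_simp
  ring

theorem one_le_choose_mul_lubellWeight {A : Finset (Fin (2 * m + 1))}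
    (hA : ¬ (#A = m ∨ #A = m + 1)) :
    1 ≤ ((2 * m + 1).choose (m + 2) : ℚ) * lubellWeight A := by
  have hc : #A ≤ 2 * m + 1 := by simpa using A.card_le_univ
  have hpos : 0 < ((2 * m + 1).choose #A : ℚ) := by exact_mod_cast Nat.choose_pos hc
  rw [lubellWeight, Fintype.card_fin, ← div_eq_mul_inv, one_le_div hpos, Nat.cast_le]
  by_cases h : #A + 1 = m ∨ #A = m + 2
  · exact (choose_eq_choose_add_two h).le
  · exact (choose_lt_choose_add_two hc (by omega)).le

theorem one_lt_choose_mul_lubellWeight {A : Finset (Fin (2 * m + 1))}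
    (hA : ¬ (#A = m ∨ #A = m + 1)) (hA' : ¬ (#A + 1 = m ∨ #A = m + 2)) :
    1 < ((2 * m + 1).choose (m + 2) : ℚ) * lubellWeight A := by
  have hc : #A ≤ 2 * m + 1 := by simpa using A.card_le_univ
  have hpos : 0 < ((2 * m + 1).choose #A : ℚ) := by exact_mod_cast Nat.choose_pos hc
  rw [lubellWeight, Fintype.card_fin, ← div_eq_mul_inv, one_lt_div hpos, Nat.cast_lt]
  exact choose_lt_choose_add_two hc (by omega)

theorem choose_add_two_lt_choose_middle (hm : 1 ≤ m) :
    (2 * m + 1).choose (m + 2) < (2 * m + 1).choose m := by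
  rw [← Nat.choose_symm_half]
  exact Nat.choose_lt_choose_of_half_lt (by omega) (by omega) (by omega)

theorem choose_middle_add_two_lt (hm : 9 ≤ m) :
    (2 * m + 1).choose m + 2 < 2 * (2 * m + 1).choose (m + 2) := by
  have h := Nat.choose_succ_right_eq (2 * m + 1) (m + 1)
  rw [Nat.choose_symm_half, show 2 * m + 1 - (m + 1) = m by omega,
    show m + 1 + 1 = m + 2 by omega] at h
  have h' : 2 * m + 1 ≤ (2 * m + 1).choose m := by
    have := Nat.choose_le_middle 1 (2 * m + 1)
    rwa [Nat.choose_one_right, show (2 * m + 1) / 2 = m by omega] at this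
  nlinarith

theorem Intersecting.card_two_middle_levels_le (hF : Intersecting F) :
    #{A ∈ F | #A = m ∨ #A = m + 1} ≤ (2 * m + 1).choose m := by
  have := hF.card_two_levels_le (k := m) (l := m + 1)
    (by rw [Fintype.card_fin]; omega)
  rwa [Fintype.card_fin, Nat.choose_symm_half] at this

/-- For intersecting families, a Lubell bound gives a cardinality bound. -/
theorem Intersecting.card_le_of_lubellWeight (hm : 1 ≤ m) (hF : Intersecting F) :
    (#F : ℚ) ≤ (2 * m + 1).choose m
      + (2 * m + 1).choose (m + 2) * (∑ A ∈ F, lubellWeight A - 1) := by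
  have hP : (0 : ℚ) < (2 * m + 1).choose m := by exact_mod_cast Nat.choose_pos (by omega)
  have hQ : ((2 * m + 1).choose (m + 2) : ℚ) < (2 * m + 1).choose m := by
    exact_mod_cast choose_add_two_lt_choose_middle hm
  have hmid : (#{A ∈ F | #A = m ∨ #A = m + 1} : ℚ) / (2 * m + 1).choose m ≤ 1 := by
    rw [div_le_one hP]
    exact_mod_cast hF.card_two_middle_levels_le
  have hrest : 0 ≤ ∑ A ∈ F with ¬ (#A = m ∨ #A = m + 1),
      ((2 * m + 1).choose (m + 2) * lubellWeight A - 1) :=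
    sum_nonneg fun A hA => sub_nonneg.2 (one_le_choose_mul_lubellWeight (mem_filter.1 hA).2)
  have := mul_nonneg (sub_pos.2 hQ).le (sub_nonneg.2 hmid)
  linarith [card_eq_of_lubellWeight F]

/-- The equality case of the cardinality bound: the two middle levels are as full as possible,
and all other members lie on the two neighbouring levels. -/
theorem Intersecting.card_two_middle_levels_eq (hm : 1 ≤ m) (hF : Intersecting F)
    (hw : ∑ A ∈ F, lubellWeight A ≤ 2)
    (hcard : #F = (2 * m + 1).choose m + (2 * m + 1).choose (m + 2)) :
    #{A ∈ F | #A = m ∨ #A = m + 1} = (2 * m + 1).choose m ∧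
      ∀ A ∈ F, ¬ (#A = m ∨ #A = m + 1) → #A + 1 = m ∨ #A = m + 2 := by
  have hP : (0 : ℚ) < (2 * m + 1).choose m := by exact_mod_cast Nat.choose_pos (by omega)
  have hQ : ((2 * m + 1).choose (m + 2) : ℚ) < (2 * m + 1).choose m := by
    exact_mod_cast choose_add_two_lt_choose_middle hm
  have hmid : (#{A ∈ F | #A = m ∨ #A = m + 1} : ℚ) / (2 * m + 1).choose m ≤ 1 := by
    rw [div_le_one hP]
    exact_mod_cast hF.card_two_middle_levels_le
  have hnn : ∀ A ∈ ({A ∈ F | ¬ (#A = m ∨ #A = m + 1)} : Finset _),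
      0 ≤ ((2 * m + 1).choose (m + 2) : ℚ) * lubellWeight A - 1 := fun A hA =>
    sub_nonneg.2 (one_le_choose_mul_lubellWeight (mem_filter.1 hA).2)
  have hrest := sum_nonneg hnn
  have hprod := mul_nonneg (sub_pos.2 hQ).le (sub_nonneg.2 hmid)
  have hid := card_eq_of_lubellWeight F
  have hwQ := mul_le_mul_of_nonneg_left (sub_le_sub_right hw 1)
    (Nat.cast_nonneg (α := ℚ) ((2 * m + 1).choose (m + 2)))
  rw [hcard, Nat.cast_add] at hid
  constructor
  · have h0 := (mul_eq_zero.1 (le_antisymm (by linarith) hprod)).resolve_left (sub_pos.2 hQ).ne'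
    rw [sub_eq_zero, eq_div_iff hP.ne', one_mul] at h0
    exact_mod_cast h0.symm
  · intro A hA hAm
    by_contra hA'
    have h0 := (sum_eq_zero_iff_of_nonneg hnn).1 (le_antisymm (by linarith) hrest) A
      (mem_filter.2 ⟨hA, hAm⟩)
    linarith [one_lt_choose_mul_lubellWeight hAm hA']

/-- An extremal butterfly-free intersecting family does not contain the whole ground set. -/
theorem Intersecting.univ_notMem_of_butterflyFree (hm : 9 ≤ m) (hF : Intersecting F)
    (hB : ButterflyFree F)
    (hcard : #F = (2 * m + 1).choose m + (2 * m + 1).choose (m + 2)) : univ ∉ F := by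
  intro hu
  set H := F.erase univ with hH
  have hHF : H ⊆ F := erase_subset _ _
  have hssub : ∀ A ∈ H, A ⊂ univ := fun A hA => ssubset_univ_iff.2 (ne_of_mem_erase hA)
  have hHi : Intersecting H := fun A hA B hB => hF A (hHF hA) B (hHF hB)
  have h0 : ∅ ∉ H := fun h => by simpa using hHi ∅ h ∅ h
  have hlam : ∀ A ∈ H, ∀ B ∈ H, ∀ C ∈ H, B ⊂ A → C ⊂ A → B = C := by
    intro A hA B hB' C hC hBA hCA
    by_contra hBC
    exact hB.false_of_ssubset (hHF hB') (hHF hC) (hHF hA) hu hBC (hssub A hA).ne hBA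
      (hssub B hB') hCA (hssub C hC)
  have key := sum_lubellWeight_add_sum_minimal_le_two h0 hlam
  have hcardH : #H + 1 = #F := card_erase_add_one hu
  have hnum := choose_middle_add_two_lt hm
  have hlt := choose_add_two_lt_choose_middle (m := m) (by omega)
  have hanti : IsAntichain (· ⊆ ·)
      (({A ∈ H | ¬ ∀ B ∈ H, ¬ B ⊂ A} : Finset (Finset (Fin (2 * m + 1)))) :
        Set (Finset (Fin (2 * m + 1)))) := by
    intro A hA B hB' hAB hsub
    have hA := mem_filter.1 hA
    have hB' := mem_filter.1 hB'
    obtain ⟨hA, hX⟩ := hA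
    push Not at hX
    obtain ⟨X, hX, hXA⟩ := hX
    have hAB := LE.le.ssubset_of_ne hsub hAB
    exact hXA.ne (hlam B hB'.1 X hX A hA (hXA.trans hAB) hAB)
  have hsperner := hanti.sperner
  rw [Fintype.card_fin, show (2 * m + 1) / 2 = m by omega] at hsperner
  have hsplit := card_filter_add_card_filter_not (s := H) (fun A => ∀ B ∈ H, ¬ B ⊂ A)
  have hmin : 2 ≤ #{A ∈ H | ∀ B ∈ H, ¬ B ⊂ A} := by omega
  have hP : (0 : ℚ) < (2 * m + 1).choose m := by exact_mod_cast Nat.choose_pos (by omega)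
  have hwmin : 2 / ((2 * m + 1).choose m : ℚ)
      ≤ ∑ A ∈ H with (∀ B ∈ H, ¬ B ⊂ A), lubellWeight A := by
    calc 2 / ((2 * m + 1).choose m : ℚ)
        ≤ #{A ∈ H | ∀ B ∈ H, ¬ B ⊂ A} * ((2 * m + 1).choose m : ℚ)⁻¹ := by
          rw [div_eq_mul_inv]
          gcongr
          exact_mod_cast hmin
      _ = ∑ A ∈ H with (∀ B ∈ H, ¬ B ⊂ A), ((2 * m + 1).choose m : ℚ)⁻¹ := by
          rw [sum_const, nsmul_eq_mul]
      _ ≤ _ := by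
          refine sum_le_sum fun A _ => ?_
          have hpos := Nat.choose_pos A.card_le_univ
          have hle := Nat.choose_le_middle #A (2 * m + 1)
          rw [show (2 * m + 1) / 2 = m by omega] at hle
          rw [Fintype.card_fin] at hpos
          rw [lubellWeight, Fintype.card_fin]
          gcongr
  have hbound := hHi.card_le_of_lubellWeight (by omega)
  have hQ : (1 : ℚ) < (2 * m + 1).choose (m + 2) * (2 / (2 * m + 1).choose m) := by
    rw [mul_div_assoc', one_lt_div hP]
    exact_mod_cast (show _ < _ by omega)
  have hle := mul_le_mul_of_nonneg_left
    (show ∑ A ∈ H, lubellWeight A - 1 ≤ 1 - 2 / ((2 * m + 1).choose m : ℚ) by linarith)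
    (Nat.cast_nonneg (α := ℚ) ((2 * m + 1).choose (m + 2)))
  have hcardQ : (#H : ℚ) + 1 = (2 * m + 1).choose m + (2 * m + 1).choose (m + 2) := by
    exact_mod_cast hcardH.trans hcard
  linarith

theorem Intersecting.eq_two_levels_of_butterflyFree (hm : 9 ≤ m) (hF : Intersecting F)
    (hB : ButterflyFree F)
    (hcard : #F = (2 * m + 1).choose m + (2 * m + 1).choose (m + 2)) :
    F = ({S | #S = m + 1 ∨ #S = m + 2} : Finset (Finset (Fin (2 * m + 1)))) := by
  have hfin : Fintype.card (Fin (2 * m + 1)) = 2 * m + 1 := Fintype.card_fin _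
  have h0 : ∅ ∉ F := fun h => by simpa using hF ∅ h ∅ h
  have hw := hB.sum_lubellWeight_le_two h0 (hF.univ_notMem_of_butterflyFree hm hB hcard)
  obtain ⟨hmid, hlev⟩ := hF.card_two_middle_levels_eq (by omega) hw hcard
  have houter : (2 * m + 1).choose (m + 2) ≤ #{A ∈ F | #A = m - 1 ∨ #A = m + 2} := by
    have hsplit := card_filter_add_card_filter_not (s := F) (fun A => #A = m ∨ #A = m + 1)
    have hle : #{A ∈ F | ¬ (#A = m ∨ #A = m + 1)} ≤ #{A ∈ F | #A = m - 1 ∨ #A = m + 2} := by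
      refine card_le_card fun A hA => ?_
      obtain ⟨hA, h⟩ := mem_filter.1 hA
      exact mem_filter.2 ⟨hA, by have := hlev A hA h; omega⟩
    omega
  have hself : ∀ B : Finset (Fin (2 * m + 1)), m - 1 ≤ #B → #B ≤ m + 2 → B ∈ F ∨ Bᶜ ∈ F := by
    intro B h1 h2
    by_cases h : #B = m ∨ #B = m + 1
    · exact hF.mem_or_compl_mem (by omega)
        (by rw [hfin, Nat.choose_symm_half, hmid]) h
    · exact hF.mem_or_compl_mem (k := m - 1) (l := m + 2) (by omega)
        (by rwa [hfin]) (by omega)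
  have hup : ∀ A ∈ F, ∀ B, A ⊆ B → m - 1 ≤ #B → #B ≤ m + 2 → B ∈ F := fun A hA B hAB h1 h2 =>
    (hself B h1 h2).resolve_right (hF.compl_notMem hA hAB)
  have hno : ∀ A ∈ F, #A ≠ m := by
    intro A hA hAm
    have hcompl : 2 < #Aᶜ := by
      rw [card_compl]
      omega
    obtain ⟨x, hx, y, hy, z, hz, hxy, hxz, hyz⟩ := two_lt_card.1 hcompl
    rw [mem_compl] at hx hy hz
    have hxA : #(insert x A) = m + 1 := by rw [card_insert_of_notMem hx, hAm]
    have hyx : y ∉ insert x A := by simp [hy, hxy.symm]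
    have hzx : z ∉ insert x A := by simp [hz, hxz.symm]
    have hyA : #(insert y (insert x A)) = m + 2 := by rw [card_insert_of_notMem hyx, hxA]
    have hzA : #(insert z (insert x A)) = m + 2 := by rw [card_insert_of_notMem hzx, hxA]
    have s1 := ssubset_insert hx
    have s2 := ssubset_insert hyx
    have s3 := ssubset_insert hzx
    refine hB.false_of_ssubset hA (hup A hA _ s1.1 (by omega) (by omega))
      (hup A hA _ (s1.trans s2).1 (by omega) (by omega))
      (hup A hA _ (s1.trans s3).1 (by omega) (by omega)) s1.ne ?_
      (s1.trans s2) (s1.trans s3) s2 s3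
    intro h
    have : y ∈ insert z (insert x A) := h ▸ mem_insert_self _ _
    exact (mem_insert.1 this).elim hyz hyx
  have hno' : ∀ A ∈ F, #A ≠ m - 1 := by
    intro A hA hAm
    obtain ⟨x, hx⟩ : Aᶜ.Nonempty := by
      rw [← card_pos, card_compl]
      omega
    rw [mem_compl] at hx
    have hxA : #(insert x A) = m := by
      rw [card_insert_of_notMem hx, hAm]
      omega
    exact hno _ (hup A hA _ (subset_insert x A) (by omega) (by omega)) hxA
  ext B
  rw [mem_filter_univ]
  constructor
  · intro hBF
    have h1 := hlev B hBF
    have h2 := hno B hBF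
    have h3 := hno' B hBF
    omega
  · intro h
    refine (hself B (by omega) (by omega)).resolve_right fun hc => ?_
    have h1 := hno _ hc
    have h2 := hno' _ hc
    rw [card_compl] at h1 h2
    omega

end OddGroundSet

theorem sigmaI_two_mul_add_one_two (m : ℕ) :
    SigmaI (2 * m + 1) 2 = (2 * m + 1).choose m + (2 * m + 1).choose (m + 2) := by
  rw [SigmaI, if_pos (by omega), show (2 * m + 1 + 1) / 2 = m + 1 by omega,
    show m + 1 + 2 - 1 = m + 1 + 1 by omega, Finset.sum_Icc_succ_top (by omega)]
  simp [Nat.choose_symm_half]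

theorem intersecting_butterflyFree_eq_odd (n : ℕ) (hn : 18 ≤ n) (hodd : n % 2 = 1)
    (F : Finset (Finset (Fin n))) (hF : Intersecting F) (hB : ButterflyFree F)
    (hcard : F.card = SigmaI n 2) :
    F = Finset.univ.filter (fun S : Finset (Fin n) =>
      S.card = n / 2 + 1 ∨ S.card = n / 2 + 2) := by
  obtain ⟨m, rfl⟩ : ∃ m, n = 2 * m + 1 := ⟨n / 2, by omega⟩
  rw [sigmaI_two_mul_add_one_two] at hcard
  rw [show (2 * m + 1) / 2 = m by omega]
  exact hF.eq_two_levels_of_butterflyFree (by omega) hB hcard
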